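/- arXiv:1807.08104 — 2 statements merged into one kernel-verified Lean document; each statement's English description precedes it below -/
import Mathlib

section
/- For every n with 3 ≤ n ≤ 10, γ_{×3,t}(K_n □ K_n) = 2n + 2. -/
open SimpleGraph

/-- The `n × m` rook's graph, i.e. the Cartesian product `K_n □ K_m`. -/
def rook (n m : ℕ) : SimpleGraph (Fin n × Fin m) :=
  (⊤ : SimpleGraph (Fin n)) □ (⊤ : SimpleGraph (Fin m))

/-- `S` is a `k`-tuple total dominating set of `G`: every vertex has at least `k`
neighbours in `S`. -/
def IsTDS {V : Type*} (G : SimpleGraph V) (k : ℕ) (S : Set V) : Prop :=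
  ∀ v : V, k ≤ (S ∩ G.neighborSet v).ncard

/-- The `k`-tuple total domination number `γ_{×k,t}(K_n □ K_m)`. -/
noncomputable def gammaXt (k n m : ℕ) : ℕ :=
  sInf {c | ∃ S : Set (Fin n × Fin m), IsTDS (rook n m) k S ∧ S.ncard = c}


open Finset in
/-- The neighbours of `(u, v)` in `T` are counted by the row of `u` and the column of `v`, each of
which also contains `(u, v)` itself when `(u, v) ∈ T`. -/
lemma ncard_inter_rook_neighborSet {n m : ℕ} (T : Finset (Fin n × Fin m)) (u : Fin n)
    (v : Fin m) :
    ((T : Set (Fin n × Fin m)) ∩ (rook n m).neighborSet (u, v)).ncard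
        + 2 * (if (u, v) ∈ T then 1 else 0)
      = #{x ∈ T | x.1 = u} + #{x ∈ T | x.2 = v} := by
  have hN : (T : Set (Fin n × Fin m)) ∩ (rook n m).neighborSet (u, v)
      = (({x ∈ T | x.1 = u}.erase (u, v) ∪ {x ∈ T | x.2 = v}.erase (u, v) :
          Finset (Fin n × Fin m)) : Set (Fin n × Fin m)) := by
    ext ⟨a, b⟩
    simp only [rook, Set.mem_inter_iff, mem_coe, mem_neighborSet, boxProd_adj, top_adj,
      mem_union, mem_erase, mem_filter, ne_eq, Prod.mk.injEq]
    grind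
  have hd : Disjoint ({x ∈ T | x.1 = u}.erase (u, v)) ({x ∈ T | x.2 = v}.erase (u, v)) := by
    rw [Finset.disjoint_left]
    rintro ⟨a, b⟩
    simp only [mem_erase, mem_filter, ne_eq, Prod.mk.injEq]
    grind
  rw [hN, Set.ncard_coe_finset, card_union_of_disjoint hd]
  split_ifs with h
  · have h1 : (u, v) ∈ ({x ∈ T | x.1 = u} : Finset _) := by simp [h]
    have h2 : (u, v) ∈ ({x ∈ T | x.2 = v} : Finset _) := by simp [h]
    have := card_erase_add_one h1
    have := card_erase_add_one h2
    omega
  · rw [erase_eq_of_notMem (by simp [h]), erase_eq_of_notMem (by simp [h])]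
    omega

open Finset in
lemma isTDS_rook_iff {n m k : ℕ} (T : Finset (Fin n × Fin m)) :
    IsTDS (rook n m) k (T : Set (Fin n × Fin m)) ↔
      ∀ u v, k + 2 * (if (u, v) ∈ T then 1 else 0)
        ≤ #{x ∈ T | x.1 = u} + #{x ∈ T | x.2 = v} := by
  simp only [IsTDS, Prod.forall, ← ncard_inter_rook_neighborSet, add_le_add_iff_right]

open Finset in
lemma sum_card_col {n m : ℕ} (T : Finset (Fin n × Fin m)) :
    ∑ v, #{x ∈ T | x.2 = v} = #T :=
  (card_eq_sum_card_fiberwise (by simp)).symm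

open Finset in
lemma sum_card_row {n m : ℕ} (T : Finset (Fin n × Fin m)) :
    ∑ u, #{x ∈ T | x.1 = u} = #T :=
  (card_eq_sum_card_fiberwise (by simp)).symm

open Finset in
lemma sum_ite_mem_row {n m : ℕ} (T : Finset (Fin n × Fin m)) (u : Fin n) :
    ∑ v, (if (u, v) ∈ T then 1 else 0) = #{x ∈ T | x.1 = u} := by
  rw [← card_filter]
  refine card_bij (fun v _ => (u, v)) ?_ ?_ ?_
  · simp
  · simp
  · rintro ⟨a, b⟩ h
    simp only [mem_filter] at h
    obtain ⟨h, rfl⟩ := h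
    exact ⟨b, by simpa using h, rfl⟩

open Finset in
lemma sum_ite_mem_col {n m : ℕ} (T : Finset (Fin n × Fin m)) (v : Fin m) :
    ∑ u, (if (u, v) ∈ T then 1 else 0) = #{x ∈ T | x.2 = v} := by
  rw [← card_filter]
  refine card_bij (fun u _ => (u, v)) ?_ ?_ ?_
  · simp
  · simp
  · rintro ⟨a, b⟩ h
    simp only [mem_filter] at h
    obtain ⟨h, rfl⟩ := h
    exact ⟨a, by simpa using h, rfl⟩

open Finset in
/-- A 3-tuple total dominating set of `K_n □ K_n` has at least `2n + 2` elements: sum the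
domination inequality along a row or column with at most two elements. -/
lemma two_mul_add_two_le_card_of_isTDS {n : ℕ} (hn : 2 ≤ n) (T : Finset (Fin n × Fin n))
    (hT : IsTDS (rook n n) 3 (T : Set (Fin n × Fin n))) : 2 * n + 2 ≤ #T := by
  rw [isTDS_rook_iff] at hT
  have hrow : ∀ u, n * 3 + 2 * #{x ∈ T | x.1 = u} ≤ n * #{x ∈ T | x.1 = u} + #T := by
    intro u
    have := sum_le_sum fun v (_ : v ∈ univ) => hT u v
    simpa only [sum_add_distrib, ← mul_sum, sum_ite_mem_row, sum_card_col, sum_const, card_univ,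
      Fintype.card_fin, smul_eq_mul] using this
  have hcol : ∀ v, n * 3 + 2 * #{x ∈ T | x.2 = v} ≤ #T + n * #{x ∈ T | x.2 = v} := by
    intro v
    have := sum_le_sum fun u (_ : u ∈ univ) => hT u v
    simpa only [sum_add_distrib, ← mul_sum, sum_ite_mem_col, sum_card_row, sum_const, card_univ,
      Fintype.card_fin, smul_eq_mul] using this
  by_contra! hlt
  have hcol2 : ∀ v, 2 ≤ #{x ∈ T | x.2 = v} := by
    intro v
    have := hcol v
    by_contra! h
    interval_cases #{x ∈ T | x.2 = v} <;> omega
  obtain ⟨u, hu⟩ : ∃ u, #{x ∈ T | x.1 = u} ≤ 2 := by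
    by_contra! h
    have := sum_le_sum fun u (_ : u ∈ univ) => Nat.succ_le_of_lt (h u)
    simp only [sum_card_row, sum_const, card_univ, Fintype.card_fin, smul_eq_mul] at this
    omega
  have hu2 : #{x ∈ T | x.1 = u} = 2 := by
    have := hrow u
    interval_cases #{x ∈ T | x.1 = u} <;> omega
  have hle : ∀ v, 2 + (if (u, v) ∈ T then 1 else 0) ≤ #{x ∈ T | x.2 = v} := by
    intro v
    have h1 := hT u v
    have h2 := hcol2 v
    split_ifs at h1 ⊢ <;> omega
  have := sum_le_sum fun v (_ : v ∈ univ) => hle v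
  rw [sum_add_distrib, sum_ite_mem_row, sum_card_col, hu2] at this
  simp only [sum_const, card_univ, Fintype.card_fin, smul_eq_mul] at this
  omega

/-- Membership of the cell `(i, j)` in a minimum 3-tuple total dominating set of `K_n □ K_n`.
For `6 ≤ n` it has four cells in column `0`, and two cells in each other column, placed cyclically
in the remaining `n - 4` rows. -/
def extremalCell (n i j : ℕ) : Bool :=
  if n = 3 then i + j ≠ 0
  else if n = 4 then decide (i < 2 ↔ 2 ≤ j) || (i == j && decide (i < 2))
  else if n = 5 then decide (i < 2 ↔ 2 ≤ j)
  else if j = 0 then i < 4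
  else 4 ≤ i && (i - 4 == 2 * (j - 1) % (n - 4) || i - 4 == (2 * (j - 1) + 1) % (n - 4))

/-- A minimum 3-tuple total dominating set of `K_n □ K_n` for `3 ≤ n ≤ 10`. -/
def extremalSet (n : ℕ) : Finset (Fin n × Fin n) :=
  {x | extremalCell n x.1 x.2}

lemma card_extremalSet {n : ℕ} (h3 : 3 ≤ n) (h10 : n ≤ 10) :
    (extremalSet n).card = 2 * n + 2 := by
  interval_cases n <;> decide +kernel

lemma isTDS_extremalSet {n : ℕ} (h3 : 3 ≤ n) (h10 : n ≤ 10) :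
    IsTDS (rook n n) 3 (extremalSet n : Set (Fin n × Fin n)) := by
  rw [isTDS_rook_iff]
  interval_cases n <;> decide +kernel

theorem stmt_7 (n : ℕ) (h3 : 3 ≤ n) (h10 : n ≤ 10) :
    gammaXt 3 n n = 2 * n + 2 := by
  refine IsLeast.csInf_eq ⟨⟨_, isTDS_extremalSet h3 h10, ?_⟩, ?_⟩
  · rw [Set.ncard_coe_finset, card_extremalSet h3 h10]
  · rintro c ⟨S, hS, rfl⟩
    lift S to Finset (Fin n × Fin n) using S.toFinite
    rw [Set.ncard_coe_finset]
    exact two_mul_add_two_le_card_of_isTDS (by omega) S hS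
end

section
/- Let m > n ≥ 3 and assume γ_{×3,t}(K_n □ K_m) < 3n. Then γ_{×3,t}(K_n □ K_m) ≤ γ_{×3,t}(K_{n+1} □ K_m) ≤ γ_{×3,t}(K_n □ K_m) + 2. -/
open SimpleGraph

/-- The number of elements of `S` in row `i`. -/
noncomputable def rowDeg {n m : ℕ} (S : Set (Fin n × Fin m)) (i : Fin n) : ℕ :=
  {j | (i, j) ∈ S}.ncard

/-- The number of elements of `S` in column `j`. -/
noncomputable def colDeg {n m : ℕ} (S : Set (Fin n × Fin m)) (j : Fin m) : ℕ :=
  {i | (i, j) ∈ S}.ncard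

lemma Set.ncard_setOf_eq_sum {α : Type*} [Fintype α] (p : α → Prop) [DecidablePred p] :
    {a | p a}.ncard = ∑ a, if p a then 1 else 0 := by
  rw [Set.ncard_eq_toFinset_card', Set.toFinset_ofPred, Finset.card_filter]

lemma sum_rowDeg {n m : ℕ} (S : Set (Fin n × Fin m)) : ∑ i, rowDeg S i = S.ncard := by
  classical
  have h : S.ncard = ∑ p, if p ∈ S then 1 else 0 := Set.ncard_setOf_eq_sum (· ∈ S)
  simp only [rowDeg, Set.ncard_setOf_eq_sum, h, Fintype.sum_prod_type]

lemma sum_colDeg {n m : ℕ} (S : Set (Fin n × Fin m)) : ∑ j, colDeg S j = S.ncard := by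
  classical
  have h : S.ncard = ∑ p, if p ∈ S then 1 else 0 := Set.ncard_setOf_eq_sum (· ∈ S)
  simp only [colDeg, Set.ncard_setOf_eq_sum, h, Fintype.sum_prod_type_right]

lemma mul_le_ncard_of_le_rowDeg {n m k : ℕ} {S : Set (Fin n × Fin m)}
    (h : ∀ i, k ≤ rowDeg S i) : k * n ≤ S.ncard := by
  have := Finset.card_nsmul_le_sum Finset.univ (rowDeg S) k fun i _ => h i
  rw [sum_rowDeg] at this
  simpa [mul_comm] using this

lemma mul_le_ncard_of_le_colDeg {n m k : ℕ} {S : Set (Fin n × Fin m)}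
    (h : ∀ j, k ≤ colDeg S j) : k * m ≤ S.ncard := by
  have := Finset.card_nsmul_le_sum Finset.univ (colDeg S) k fun i _ => h i
  rw [sum_colDeg] at this
  simpa [mul_comm] using this

lemma ncard_inter_neighborSet_rook {n m : ℕ} (S : Set (Fin n × Fin m)) (i : Fin n) (j : Fin m) :
    (S ∩ (rook n m).neighborSet (i, j)).ncard =
      ({j' | (i, j') ∈ S} \ {j}).ncard + ({i' | (i', j) ∈ S} \ {i}).ncard := by
  have h : S ∩ (rook n m).neighborSet (i, j) =
      Prod.mk i '' ({j' | (i, j') ∈ S} \ {j}) ∪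
        (fun i' => (i', j)) '' ({i' | (i', j) ∈ S} \ {i}) := by
    ext ⟨a, b⟩
    simp only [rook, Set.mem_inter_iff, mem_neighborSet, boxProd_adj, top_adj, Set.mem_union,
      Set.mem_image, Set.mem_sdiff, Set.mem_ofPred_eq, Set.mem_singleton_iff, Prod.mk.injEq]
    grind
  rw [h, Set.ncard_union_eq, Set.ncard_image_of_injective, Set.ncard_image_of_injective]
  · intro a b hab; simpa using hab
  · intro a b hab; simpa using hab
  · rw [Set.disjoint_left]
    rintro _ ⟨b, hb, rfl⟩ ⟨a, ha, hab⟩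
    simp only [Prod.mk.injEq] at hab
    exact hb.2 hab.2.symm

lemma isTDS_rook_iff_s10 {n m : ℕ} (S : Set (Fin n × Fin m)) :
    IsTDS (rook n m) 3 S ↔ ∀ i j, 3 ≤ rowDeg S i + colDeg S j ∧
      ((i, j) ∈ S → 5 ≤ rowDeg S i + colDeg S j) := by
  simp only [IsTDS, Prod.forall, ncard_inter_neighborSet_rook, rowDeg, colDeg]
  refine forall₂_congr fun i j => ?_
  by_cases h : (i, j) ∈ S
  · have h₁ := Set.ncard_sdiff_singleton_add_one (s := {j' | (i, j') ∈ S}) (a := j) h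
    have h₂ := Set.ncard_sdiff_singleton_add_one (s := {i' | (i', j) ∈ S}) (a := i) h
    simp only [h, true_imp_iff]
    omega
  · rw [Set.sdiff_singleton_eq_self (by simpa using h),
      Set.sdiff_singleton_eq_self (by simpa using h)]
    simp [h]

lemma gammaXt_le_ncard {k n m : ℕ} {S : Set (Fin n × Fin m)} (h : IsTDS (rook n m) k S) :
    gammaXt k n m ≤ S.ncard :=
  Nat.sInf_le ⟨S, h, rfl⟩

lemma exists_isTDS_ncard_eq_gammaXt {n m : ℕ} (h : 5 ≤ n + m) :
    ∃ S : Set (Fin n × Fin m), IsTDS (rook n m) 3 S ∧ S.ncard = gammaXt 3 n m := by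
  refine Nat.sInf_mem
    (s := {c | ∃ S : Set (Fin n × Fin m), IsTDS (rook n m) 3 S ∧ S.ncard = c})
    ⟨_, Set.univ, ?_, rfl⟩
  rw [isTDS_rook_iff_s10]
  intro i j
  simp only [rowDeg, colDeg, Set.mem_univ, Set.ofPred_true, Set.ncard_univ, Nat.card_eq_fintype_card,
    Fintype.card_fin]
  omega

/-- A set with fewer than `3 * n` elements dominating the rook's graph has no empty column. -/
lemma IsTDS.one_le_colDeg {n m : ℕ} {S : Set (Fin n × Fin m)} (hS : IsTDS (rook n m) 3 S)
    (h : S.ncard < 3 * n) (j : Fin m) : 1 ≤ colDeg S j := by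
  rw [isTDS_rook_iff_s10] at hS
  by_contra! hj
  have := mul_le_ncard_of_le_rowDeg (S := S) (k := 3) fun i => by have := (hS i j).1; omega
  omega

lemma IsTDS.one_le_rowDeg {n m : ℕ} {S : Set (Fin n × Fin m)} (hS : IsTDS (rook n m) 3 S)
    (h : S.ncard < 3 * m) (i : Fin n) : 1 ≤ rowDeg S i := by
  rw [isTDS_rook_iff_s10] at hS
  by_contra! hi
  have := mul_le_ncard_of_le_colDeg (S := S) (k := 3) fun j => by have := (hS i j).1; omega
  omega

lemma IsTDS.exists_pair_two_le_colDeg {n m : ℕ} {S : Set (Fin n × Fin m)}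
    (hS : IsTDS (rook n m) 3 S) (hn : S.ncard < 3 * n) (hm : S.ncard < 3 * m) (hm2 : 2 ≤ m) :
    ∃ j₁ j₂, j₁ ≠ j₂ ∧ 2 ≤ colDeg S j₁ ∧ 2 ≤ colDeg S j₂ := by
  have hrow := hS.one_le_rowDeg hm
  rw [isTDS_rook_iff_s10] at hS
  obtain ⟨i, hi⟩ : ∃ i, rowDeg S i ≤ 2 := by
    by_contra! h
    have := mul_le_ncard_of_le_rowDeg h
    omega
  rcases Nat.lt_or_ge (rowDeg S i) 2 with h | h
  · refine ⟨⟨0, by omega⟩, ⟨1, by omega⟩, by simp, ?_, ?_⟩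
    · have := (hS i ⟨0, by omega⟩).1; omega
    · have := (hS i ⟨1, by omega⟩).1; omega
  · obtain ⟨j₁, j₂, h₁, h₂, hne⟩ := (Set.one_lt_ncard_iff (Set.toFinite _)).1 h
    refine ⟨j₁, j₂, hne, ?_, ?_⟩
    · have := (hS i j₁).2 h₁; omega
    · have := (hS i j₂).2 h₂; omega

lemma gammaXt_succ_le_add_two {n m : ℕ} (hn : 3 ≤ n) (hnm : n < m)
    (hsmall : gammaXt 3 n m < 3 * n) : gammaXt 3 (n + 1) m ≤ gammaXt 3 n m + 2 := by
  classical
  obtain ⟨S, hS, hcard⟩ := exists_isTDS_ncard_eq_gammaXt (n := n) (m := m) (by omega)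
  rw [← hcard] at hsmall ⊢
  obtain ⟨j₁, j₂, hne, h₁, h₂⟩ := hS.exists_pair_two_le_colDeg hsmall (by omega) (by omega)
  have hcol := hS.one_le_colDeg hsmall
  let T : Set (Fin (n + 1) × Fin m) :=
    {p | Fin.cases (motive := fun _ => Prop) (p.2 = j₁ ∨ p.2 = j₂) (fun i => (i, p.2) ∈ S) p.1}
  have hrow₀ : rowDeg T 0 = 2 := Set.ncard_pair hne
  have hrow (i : Fin n) : rowDeg T i.succ = rowDeg S i := rfl
  have hcolT (j : Fin m) : colDeg T j = (if j = j₁ ∨ j = j₂ then 1 else 0) + colDeg S j := by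
    simp only [colDeg, Set.ncard_setOf_eq_sum, Fin.sum_univ_succ]
    congr
  have hT : T.ncard = S.ncard + 2 := by
    rw [← sum_rowDeg, Fin.sum_univ_succ, hrow₀]
    simp only [hrow, sum_rowDeg]
    omega
  rw [← hT]
  refine gammaXt_le_ncard ?_
  rw [isTDS_rook_iff_s10] at hS ⊢
  intro i j
  rw [hcolT]
  cases i using Fin.cases with
  | zero =>
    have hmem : (0, j) ∈ T ↔ j = j₁ ∨ j = j₂ := Iff.rfl
    have := hcol j
    rw [hrow₀, hmem]
    refine ⟨by omega, ?_⟩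
    rintro (rfl | rfl) <;> simp <;> omega
  | succ i =>
    have hmem : (i.succ, j) ∈ T ↔ (i, j) ∈ S := Iff.rfl
    rw [hrow, hmem]
    have := hS i j
    exact ⟨by omega, fun h => by have := this.2 h; omega⟩

/-- Delete row `ρ` of `S`, moving its element in column `j`, if any, to row `f j`. -/
def mergeRow {n m : ℕ} (S : Set (Fin (n + 1) × Fin m)) (ρ : Fin (n + 1)) (f : Fin m → Fin n) :
    Set (Fin n × Fin m) :=
  {p | (ρ.succAbove p.1, p.2) ∈ S ∨ ((ρ, p.2) ∈ S ∧ f p.2 = p.1)}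

section mergeRow

variable {n m : ℕ} {S : Set (Fin (n + 1) × Fin m)} {ρ : Fin (n + 1)} {f : Fin m → Fin n}

lemma colDeg_eq_succAbove (j : Fin m) [Decidable ((ρ, j) ∈ S)] :
    colDeg S j = (if (ρ, j) ∈ S then 1 else 0) + {k | (ρ.succAbove k, j) ∈ S}.ncard := by
  classical
  simp only [colDeg, Set.ncard_setOf_eq_sum, Fin.sum_univ_succAbove _ ρ]
  congr

lemma rowDeg_le_rowDeg_mergeRow (k : Fin n) :
    rowDeg S (ρ.succAbove k) ≤ rowDeg (mergeRow S ρ f) k :=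
  Set.ncard_le_ncard fun _ hj => Or.inl hj

lemma rowDeg_lt_rowDeg_mergeRow {j : Fin m} (hj : (ρ, j) ∈ S)
    (hf : (ρ.succAbove (f j), j) ∉ S) :
    rowDeg S (ρ.succAbove (f j)) < rowDeg (mergeRow S ρ f) (f j) :=
  Set.ncard_lt_ncard ⟨fun _ hj => Or.inl hj, fun h => hf (h (Or.inr ⟨hj, rfl⟩))⟩

lemma colDeg_mergeRow_of_notMem {j : Fin m} (hj : (ρ, j) ∉ S) :
    colDeg (mergeRow S ρ f) j = colDeg S j := by
  classical
  rw [colDeg_eq_succAbove (S := S) (ρ := ρ), if_neg hj]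
  simp [colDeg, mergeRow, hj]

lemma colDeg_mergeRow_of_mem {j : Fin m} (hj : (ρ, j) ∈ S) (hf : (ρ.succAbove (f j), j) ∉ S) :
    colDeg (mergeRow S ρ f) j = colDeg S j := by
  classical
  rw [colDeg_eq_succAbove (S := S) (ρ := ρ), if_pos hj, add_comm,
    ← Set.ncard_insert_of_notMem (a := f j) (by simpa using hf)]
  unfold colDeg
  congr 1
  ext k
  simp [mergeRow, hj, or_comm, eq_comm]

lemma colDeg_mergeRow_of_forall {j : Fin m} (hf : ∀ k, (ρ.succAbove k, j) ∈ S) :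
    colDeg (mergeRow S ρ f) j = n := by
  simp [colDeg, mergeRow, hf]

lemma ncard_mergeRow_le (hf : ∀ j, (ρ.succAbove (f j), j) ∈ S → ∀ k, (ρ.succAbove k, j) ∈ S) :
    (mergeRow S ρ f).ncard ≤ S.ncard := by
  classical
  rw [← sum_colDeg, ← sum_colDeg]
  refine Finset.sum_le_sum fun j _ => ?_
  by_cases hj : (ρ, j) ∈ S
  · by_cases h : (ρ.succAbove (f j), j) ∈ S
    · rw [colDeg_mergeRow_of_forall (hf j h), colDeg_eq_succAbove (ρ := ρ)]
      simp [hf j h]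
    · exact (colDeg_mergeRow_of_mem hj h).le
  · exact (colDeg_mergeRow_of_notMem hj).le

lemma IsTDS.isTDS_mergeRow (hS : IsTDS (rook (n + 1) m) 3 S) (hρ : rowDeg S ρ ≤ 2)
    (hrow : ∀ i, 1 ≤ rowDeg S i) (hn : ∀ i, 5 ≤ rowDeg S i + n)
    (hf : ∀ j, (ρ.succAbove (f j), j) ∈ S → ∀ k, (ρ.succAbove k, j) ∈ S) :
    IsTDS (rook n m) 3 (mergeRow S ρ f) := by
  rw [isTDS_rook_iff_s10] at hS ⊢
  intro k j
  have hle := rowDeg_le_rowDeg_mergeRow (S := S) (ρ := ρ) (f := f) k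
  have hk := hS (ρ.succAbove k) j
  by_cases hj : (ρ, j) ∈ S
  · by_cases h : (ρ.succAbove (f j), j) ∈ S
    · have := hn (ρ.succAbove k)
      rw [colDeg_mergeRow_of_forall (hf j h)]
      omega
    · rw [colDeg_mergeRow_of_mem hj h]
      refine ⟨by omega, ?_⟩
      rintro (hmem | ⟨-, hfj : f j = k⟩)
      · have := hk.2 hmem
        omega
      · subst hfj
        have := rowDeg_lt_rowDeg_mergeRow hj h
        have := (hS ρ j).2 hj
        have := hrow (ρ.succAbove (f j))
        omega
  · rw [colDeg_mergeRow_of_notMem hj]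
    refine ⟨by omega, ?_⟩
    rintro (hmem | ⟨hmem, -⟩)
    · have := hk.2 hmem
      omega
    · exact absurd hmem hj

end mergeRow

lemma gammaXt_le_gammaXt_succ {n m : ℕ} (hn : 3 ≤ n) (hnm : n < m)
    (hsmall : gammaXt 3 n m < 3 * n) : gammaXt 3 n m ≤ gammaXt 3 (n + 1) m := by
  classical
  obtain ⟨S, hS, hcard⟩ := exists_isTDS_ncard_eq_gammaXt (n := n + 1) (m := m) (by omega)
  rw [← hcard]
  by_contra! hlt
  have hrow := hS.one_le_rowDeg (by omega)
  obtain ⟨ρ, hmin⟩ := Finite.exists_min (rowDeg S)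
  have hρ : rowDeg S ρ ≤ 2 := by
    by_contra! h
    have := mul_le_ncard_of_le_rowDeg fun i => (Nat.succ_le_of_lt h).trans (hmin i)
    omega
  have hfull (i : Fin (n + 1)) : 5 ≤ rowDeg S i + n := by
    have := hrow i
    have := hmin i
    by_contra! h
    have := mul_le_ncard_of_le_colDeg (S := S) (k := 2) fun j => by
      have := ((isTDS_rook_iff_s10 S).1 hS ρ j).1
      omega
    omega
  have hf (j : Fin m) :
      ∃ k, (ρ.succAbove k, j) ∈ S → ∀ k', (ρ.succAbove k', j) ∈ S := by
    by_contra! h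
    obtain ⟨hk, k', hk'⟩ := h ⟨0, by omega⟩
    exact hk' (h k').1
  choose f hf using hf
  have := gammaXt_le_ncard (hS.isTDS_mergeRow hρ hrow hfull hf)
  have := ncard_mergeRow_le hf
  omega

theorem stmt_10 (n m : ℕ) (hn : 3 ≤ n) (hnm : n < m)
    (hsmall : gammaXt 3 n m < 3 * n) :
    gammaXt 3 n m ≤ gammaXt 3 (n + 1) m ∧
    gammaXt 3 (n + 1) m ≤ gammaXt 3 n m + 2 :=
  ⟨gammaXt_le_gammaXt_succ hn hnm hsmall, gammaXt_succ_le_add_two hn hnm hsmall⟩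
end
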